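/- For every integer t ≥ 5, τ_t(P₂ □ P₃) = 6t − 10, where P₂ □ P₃ is the Cartesian product of the path on 2 vertices and the path on 3 vertices (the 2 × 3 grid graph). -/

import Mathlib

open SimpleGraph

/-- A `t`-tone `k`-coloring of a graph `G` assigns to each vertex a `t`-element subset of
`{1, …, k}` so that the labels of any two distinct vertices `v, w` share fewer than
`d(v,w)` colors (no constraint between different components, where the distance is infinite). -/
def IsTToneColoring {V : Type*} (G : SimpleGraph V) (t k : ℕ) (f : V → Finset ℕ) : Prop :=
  (∀ v, f v ⊆ Finset.Icc 1 k) ∧ (∀ v, (f v).card = t) ∧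
    ∀ ⦃v w : V⦄, v ≠ w → ((f v ∩ f w).card : ℕ∞) < G.edist v w

/-- The `t`-tone chromatic number: the least `k` admitting a `t`-tone `k`-coloring. -/
noncomputable def toneChromaticNumber {V : Type*} (G : SimpleGraph V) (t : ℕ) : ℕ :=
  sInf {k | ∃ f : V → Finset ℕ, IsTToneColoring G t k f}

/-- Bonferroni's lower bound for the size of a union. -/
lemma sum_card_le_card_biUnion_add_sum_card_inter {α : Type*} [DecidableEq α]
    (f : ℕ → Finset α) (n : ℕ) :
    ∑ i ∈ Finset.range n, (f i).card ≤ ((Finset.range n).biUnion f).card +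
      ∑ i ∈ Finset.range n, ∑ j ∈ Finset.range i, (f j ∩ f i).card := by
  induction n with
  | zero => simp
  | succ n ih =>
    rw [Finset.sum_range_succ, Finset.sum_range_succ, Finset.range_add_one,
      Finset.biUnion_insert]
    have h_union := Finset.card_union_add_card_inter (f n) ((Finset.range n).biUnion f)
    have h_inter : (f n ∩ (Finset.range n).biUnion f).card ≤
        ∑ j ∈ Finset.range n, (f j ∩ f n).card := by
      rw [Finset.inter_comm, Finset.biUnion_inter]
      exact Finset.card_biUnion_le
    omega

lemma natDist_le_length_pathGraph {n : ℕ} {u v : Fin n} (p : (pathGraph n).Walk u v) :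
    Nat.dist u v ≤ p.length := by
  induction p with
  | nil => simp
  | cons h p ih =>
    rw [pathGraph_adj] at h
    rw [Walk.length_cons]
    unfold Nat.dist at *
    omega

lemma edist_pathGraph_add_le {n : ℕ} (k : ℕ) (u v : Fin n) (h : u.val + k = v.val) :
    (pathGraph n).edist u v ≤ k := by
  induction k generalizing v with
  | zero => simp [Fin.ext (show u.val = v.val from h)]
  | succ k ih =>
    let w : Fin n := ⟨u + k, by omega⟩
    have h_adj : (pathGraph n).Adj w v := pathGraph_adj.2 (Or.inl (by simp only [w]; omega))
    calc (pathGraph n).edist u v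
        ≤ (pathGraph n).edist u w + (pathGraph n).edist w v := SimpleGraph.edist_triangle
      _ ≤ k + 1 := add_le_add (ih w rfl) (edist_eq_one_iff_adj.2 h_adj).le
      _ = (k + 1 : ℕ) := by push_cast; rfl

lemma edist_pathGraph {n : ℕ} (u v : Fin n) :
    (pathGraph n).edist u v = (Nat.dist u v : ℕ) := by
  apply le_antisymm
  · rcases le_total u.val v.val with h | h
    · exact edist_pathGraph_add_le _ u v (by unfold Nat.dist; omega)
    · rw [SimpleGraph.edist_comm]
      exact edist_pathGraph_add_le _ v u (by unfold Nat.dist; omega)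
  · by_cases h : (pathGraph n).edist u v = ⊤
    · simp [h]
    · obtain ⟨p, hp⟩ := exists_walk_of_edist_ne_top h
      rw [← hp]
      exact_mod_cast natDist_le_length_pathGraph p

lemma edist_grid {m n : ℕ} (v w : Fin m × Fin n) :
    (pathGraph m □ pathGraph n).edist v w =
      (Nat.dist v.1 w.1 + Nat.dist v.2 w.2 : ℕ) := by
  rw [edist_boxProd, edist_pathGraph, edist_pathGraph, Nat.cast_add]

lemma le_of_isTToneColoring_grid_2_3 {t k : ℕ} {f : Fin 2 × Fin 3 → Finset ℕ}
    (hf : IsTToneColoring (pathGraph 2 □ pathGraph 3) t k f) : 6 * t - 10 ≤ k := by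
  obtain ⟨h_sub, h_card, h_inter⟩ := hf
  let v : ℕ → Fin 2 × Fin 3 := fun i ↦ (Fin.ofNat 2 i, Fin.ofNat 3 i)
  have h_bonf := sum_card_le_card_biUnion_add_sum_card_inter (f ∘ v) 6
  have h_union : ((Finset.range 6).biUnion (f ∘ v)).card ≤ k := by
    simpa using Finset.card_le_card
      (Finset.biUnion_subset.2 fun i _ ↦ h_sub (v i) :
        (Finset.range 6).biUnion (f ∘ v) ⊆ Finset.Icc 1 k)
  have h_ne : ∀ i ∈ Finset.range 6, ∀ j ∈ Finset.range i, v j ≠ v i := by decide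
  have h_pairs : ∑ i ∈ Finset.range 6, ∑ j ∈ Finset.range i, ((f ∘ v) j ∩ (f ∘ v) i).card ≤
      ∑ i ∈ Finset.range 6, ∑ j ∈ Finset.range i,
        (Nat.dist (v j).1 (v i).1 + Nat.dist (v j).2 (v i).2 - 1) := by
    refine Finset.sum_le_sum fun i hi ↦ Finset.sum_le_sum fun j hj ↦ ?_
    have h := h_inter (h_ne i hi j hj)
    rw [edist_grid, Nat.cast_lt] at h
    exact Nat.le_sub_one_of_lt h
  have h_ten : ∑ i ∈ Finset.range 6, ∑ j ∈ Finset.range i,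
      (Nat.dist (v j).1 (v i).1 + Nat.dist (v j).2 (v i).2 - 1) = 10 := by decide
  have h_sum : ∑ i ∈ Finset.range 6, ((f ∘ v) i).card = 6 * t := by simp [h_card]
  omega

/-- The colors, taken from `{1, …, 10}`, that the optimal coloring of the `2 × 3` grid uses on
more than one vertex: each pair of vertices shares as many of them as its distance permits. -/
def sharedColors (v : Fin 2 × Fin 3) : Finset ℕ :=
  (![![{1, 3, 7, 8}, {4, 5}, {1, 6, 9, 10}],
     ![{2, 4, 9, 10}, {3, 6}, {2, 5, 7, 8}]] : Fin 2 → Fin 3 → Finset ℕ) v.1 v.2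

/-- The interval of colors that the optimal `(s + 4)`-tone coloring of the `2 × 3` grid uses on
the vertex `v` only. -/
def privateColors (s : ℕ) (v : Fin 2 × Fin 3) : Finset ℕ :=
  (![![Finset.Ioc 10 (10 + s), Finset.Ioc (10 + 4 * s) (12 + 5 * s),
       Finset.Ioc (10 + s) (10 + 2 * s)],
     ![Finset.Ioc (10 + 2 * s) (10 + 3 * s), Finset.Ioc (12 + 5 * s) (14 + 6 * s),
       Finset.Ioc (10 + 3 * s) (10 + 4 * s)]] : Fin 2 → Fin 3 → Finset ℕ) v.1 v.2

lemma sharedColors_subset (v : Fin 2 × Fin 3) : sharedColors v ⊆ Finset.Icc 1 10 := by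
  revert v; decide

lemma privateColors_subset (s : ℕ) (v : Fin 2 × Fin 3) :
    privateColors s v ⊆ Finset.Ioc 10 (14 + 6 * s) := by
  obtain ⟨i, j⟩ := v
  fin_cases i <;> fin_cases j <;>
    exact Finset.Ioc_subset_Ioc (by omega) (by omega)

lemma disjoint_privateColors (s : ℕ) {v w : Fin 2 × Fin 3} (h : v ≠ w) :
    Disjoint (privateColors s v) (privateColors s w) := by
  obtain ⟨i, j⟩ := v
  obtain ⟨i', j'⟩ := w
  rw [Finset.disjoint_left]
  intro x
  fin_cases i <;> fin_cases j <;> fin_cases i' <;> fin_cases j' <;>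
    first
    | exact absurd rfl h
    | (simp [privateColors]; omega)

lemma disjoint_sharedColors_privateColors (s : ℕ) (v w : Fin 2 × Fin 3) :
    Disjoint (sharedColors v) (privateColors s w) := by
  refine Finset.disjoint_of_subset_left (sharedColors_subset v)
    (Finset.disjoint_of_subset_right (privateColors_subset s w) ?_)
  rw [Finset.disjoint_left]
  intro x
  simp only [Finset.mem_Icc, Finset.mem_Ioc]
  omega

lemma isTToneColoring_grid_2_3 (s : ℕ) :
    IsTToneColoring (pathGraph 2 □ pathGraph 3) (s + 4) (14 + 6 * s)
      (fun v ↦ sharedColors v ∪ privateColors s v) := by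
  refine ⟨fun v ↦ ?_, fun v ↦ ?_, fun v w h ↦ ?_⟩
  · refine Finset.union_subset ((sharedColors_subset v).trans ?_)
      ((privateColors_subset s v).trans ?_) <;>
    · intro x
      simp only [Finset.mem_Icc, Finset.mem_Ioc]
      omega
  · rw [Finset.card_union_of_disjoint (disjoint_sharedColors_privateColors s v v)]
    obtain ⟨i, j⟩ := v
    fin_cases i <;> fin_cases j <;> simp [sharedColors, privateColors] <;> omega
  · have h_inter : (sharedColors v ∪ privateColors s v) ∩ (sharedColors w ∪ privateColors s w) =
        sharedColors v ∩ sharedColors w := by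
      rw [Finset.union_inter_distrib_right, Finset.inter_union_distrib_left,
        Finset.inter_union_distrib_left,
        Finset.disjoint_iff_inter_eq_empty.1 (disjoint_sharedColors_privateColors s v w),
        Finset.disjoint_iff_inter_eq_empty.1 (disjoint_sharedColors_privateColors s w v).symm,
        Finset.disjoint_iff_inter_eq_empty.1 (disjoint_privateColors s h)]
      simp
    rw [h_inter, edist_grid, Nat.cast_lt]
    clear h_inter
    revert v w
    decide

/-- `τ_t(P₂ □ P₃) = 6t - 10` for every integer `t ≥ 5`. -/
theorem tone_grid_2_3 (t : ℕ) (ht : 5 ≤ t) :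
    toneChromaticNumber (pathGraph 2 □ pathGraph 3) t = 6 * t - 10 := by
  have h_mem : 6 * t - 10 ∈
      {k | ∃ f, IsTToneColoring (pathGraph 2 □ pathGraph 3) t k f} := by
    obtain ⟨s, rfl⟩ : ∃ s, t = s + 4 := ⟨t - 4, by omega⟩
    rw [show 6 * (s + 4) - 10 = 14 + 6 * s by omega]
    exact ⟨_, isTToneColoring_grid_2_3 s⟩
  refine le_antisymm (Nat.sInf_le h_mem) (le_csInf ⟨_, h_mem⟩ ?_)
  rintro k ⟨f, hf⟩
  exact le_of_isTToneColoring_grid_2_3 hf
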